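/- For all integers 3 ≤ ℓ < r, the pair (K_ℓ, K_r) is Ramsey-infinite; that is, there exist infinitely many pairwise non-isomorphic graphs F such that F → (K_ℓ, K_r) but F′ ↛ (K_ℓ, K_r) for every proper subgraph F′ ⊊ F. -/

import Mathlib

open scoped Classical

namespace AsymRamsey

/-- The 2-density `d₂` of a graph with `v` vertices and `e` edges. -/
noncomputable def d2 (v e : ℕ) : ℝ :=
  if e = 0 then 0 else if 3 ≤ v then ((e : ℝ) - 1) / ((v : ℝ) - 2) else 1 / 2

/-- `m₂(H)`: the maximum of `d₂` over all subgraphs of `H`. -/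
noncomputable def m2 {V : Type*} [Fintype V] (H : SimpleGraph V) : ℝ :=
  sSup {x : ℝ | ∃ J : H.Subgraph, x = d2 J.verts.ncard J.edgeSet.ncard}

/-- The asymmetric 2-density `d₂(G, ·)` applied to a graph with `v` vertices and `e` edges. -/
noncomputable def d2a {V : Type*} [Fintype V] (G : SimpleGraph V) (v e : ℕ) : ℝ :=
  if G.edgeSet.ncard = 0 ∨ e = 0 then 0 else (e : ℝ) / ((v : ℝ) - 2 + 1 / m2 G)

/-- `m₂(G,H)`: the maximum of `d₂(G,·)` over all subgraphs of `H`. -/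
noncomputable def m2a {V W : Type*} [Fintype V] [Fintype W]
    (G : SimpleGraph V) (H : SimpleGraph W) : ℝ :=
  sSup {x : ℝ | ∃ J : H.Subgraph, x = d2a G J.verts.ncard J.edgeSet.ncard}

/-- `H` is balanced with respect to `d₂(G,·)`. -/
def BalancedW {V W : Type*} [Fintype V] [Fintype W]
    (G : SimpleGraph V) (H : SimpleGraph W) : Prop :=
  m2a G H = d2a G (Fintype.card W) H.edgeSet.ncard

/-- `H` is strictly balanced with respect to `d₂(G,·)`. -/
def StrictlyBalancedW {V W : Type*} [Fintype V] [Fintype W]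
    (G : SimpleGraph V) (H : SimpleGraph W) : Prop :=
  BalancedW G H ∧
    ∀ J : H.Subgraph, J ≠ ⊤ → d2a G J.verts.ncard J.edgeSet.ncard < m2a G H

/-- `m*(H) = min {(e_H - e_J)/(v_H - v_J) : J ⊆ H, 2 ≤ v_J < v_H}`. -/
noncomputable def mStar {W : Type*} [Fintype W] (H : SimpleGraph W) : ℝ :=
  sInf {x : ℝ | ∃ J : H.Subgraph, 2 ≤ J.verts.ncard ∧ J.verts.ncard < Fintype.card W ∧
    x = ((H.edgeSet.ncard : ℝ) - (J.edgeSet.ncard : ℝ)) /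
        ((Fintype.card W : ℝ) - (J.verts.ncard : ℝ))}

/-- `x*(H) = m*(H) / (e_H - m*(H)(v_H - 2))`. -/
noncomputable def xStar {W : Type*} [Fintype W] (H : SimpleGraph W) : ℝ :=
  mStar H / ((H.edgeSet.ncard : ℝ) - mStar H * ((Fintype.card W : ℝ) - 2))

/-- A graph is a matching if it has maximum degree at most 1. -/
def IsMatchingGraph {V : Type*} (G : SimpleGraph V) : Prop :=
  ∀ v : V, (G.neighborSet v).ncard ≤ 1

/-- `f` is (the embedding of) a copy of `H` in `F`. -/
def IsCopy {W V : Type*} (H : SimpleGraph W) (F : SimpleGraph V) (f : W ↪ V) : Prop :=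
  ∀ ⦃u v : W⦄, H.Adj u v → F.Adj (f u) (f v)

/-- The edges of the copy of `H` given by the embedding `f`. -/
def copyEdges {W V : Type*} (H : SimpleGraph W) (f : W ↪ V) : Set (Sym2 V) :=
  Sym2.map (⇑f) '' H.edgeSet

/-- `E_H(F)`: the union of the edge sets of all copies of `H` in `F` (the `H`-edges of `F`). -/
def HEdges {W V : Type*} (H : SimpleGraph W) (F : SimpleGraph V) : Set (Sym2 V) :=
  ⋃ f ∈ {f : W ↪ V | IsCopy H F f}, copyEdges H f

/-- `F → (G,H)`: every red-blue (true/false) coloring of the edges of `F` yields a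
red copy of `G` or a blue copy of `H`. -/
def Arrows {α β γ : Type*} (F : SimpleGraph α) (G : SimpleGraph β) (H : SimpleGraph γ) : Prop :=
  ∀ c : Sym2 α → Bool,
    (∃ f : β ↪ α, IsCopy G F f ∧ ∀ e ∈ G.edgeSet, c (Sym2.map (⇑f) e) = true) ∨
    (∃ f : γ ↪ α, IsCopy H F f ∧ ∀ e ∈ H.edgeSet, c (Sym2.map (⇑f) e) = false)

/-- `F` is Ramsey-critical for the pair `(G,H)`. -/
def Critical {α β γ : Type*} (F : SimpleGraph α) (G : SimpleGraph β) (H : SimpleGraph γ) : Prop :=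
  Arrows F G H ∧ ∀ F' : F.Subgraph, F' ≠ ⊤ → ¬ Arrows F'.coe G H

/-- The probability that the binomial random graph `G_{n,p}` satisfies property `A`. -/
noncomputable def gnpProb (n : ℕ) (p : ℝ) (A : SimpleGraph (Fin n) → Prop) : ℝ :=
  ∑ S ∈ (Finset.univ.filter fun e : Sym2 (Fin n) => ¬ e.IsDiag).powerset,
    if A (SimpleGraph.fromEdgeSet (↑S)) then p ^ S.card * (1 - p) ^ (n.choose 2 - S.card) else 0

/-- The edges of `F` induced on a vertex set `V`. -/
def EdgesIn {n : ℕ} (F : SimpleGraph (Fin n)) (V : Finset (Fin n)) : Set (Sym2 (Fin n)) :=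
  {e ∈ F.edgeSet | ∀ v ∈ e, v ∈ V}

/-- `F` is `(ρ,d)`-dense. -/
def RhoDDense (n : ℕ) (ρ d : ℝ) (F : SimpleGraph (Fin n)) : Prop :=
  ∀ V : Finset (Fin n), ρ * (n : ℝ) ≤ (V.card : ℝ) →
    d * (n.choose 2 : ℝ) ≤ ((EdgesIn F V).ncard : ℝ)

/-- The general density measure `d_{a,b}`. -/
noncomputable def dab (a b : ℝ) (v e : ℕ) : ℝ :=
  if e = 0 then 0 else ((e : ℝ) - a) / ((v : ℝ) - b)

/-- `m_{a,b}(H)`: the maximum of `d_{a,b}` over all subgraphs of `H`. -/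
noncomputable def mab {W : Type*} [Fintype W] (a b : ℝ) (H : SimpleGraph W) : ℝ :=
  sSup {x : ℝ | ∃ J : H.Subgraph, x = dab a b J.verts.ncard J.edgeSet.ncard}

/-- `H` is balanced with respect to `d_{a,b}`. -/
def BalancedAB {W : Type*} [Fintype W] (a b : ℝ) (H : SimpleGraph W) : Prop :=
  mab a b H = dab a b (Fintype.card W) H.edgeSet.ncard

/-- `H` is strictly balanced with respect to `d_{a,b}`. -/
def StrictlyBalancedAB {W : Type*} [Fintype W] (a b : ℝ) (H : SimpleGraph W) : Prop :=
  BalancedAB a b H ∧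
    ∀ J : H.Subgraph, J ≠ ⊤ → dab a b J.verts.ncard J.edgeSet.ncard < mab a b H

/-- The spanning subgraph of `G` formed by the edges that receive color `a` under `c`. -/
def colorGraph {V K : Type*} (G : SimpleGraph V) (c : Sym2 V → K) (a : K) : SimpleGraph V where
  Adj u v := G.Adj u v ∧ c s(u, v) = a
  symm := ⟨fun u v h => ⟨h.1.symm, by rw [Sym2.eq_swap]; exact h.2⟩⟩
  loopless := ⟨fun u h => G.loopless.irrefl u h.1⟩

theorem not_cliqueFree_of_image {V W : Type*} {H : SimpleGraph W} {S : Finset V} (f : V → W)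
    (hf : ∀ x ∈ S, ∀ y ∈ S, x ≠ y → H.Adj (f x) (f y)) : ¬ H.CliqueFree S.card := by
  intro hH
  refine hH (S.image f) ⟨?_, ?_⟩
  · intro x hx y hy hxy
    simp only [Finset.coe_image, Set.mem_image, Finset.mem_coe] at hx hy
    obtain ⟨a, ha, rfl⟩ := hx
    obtain ⟨b, hb, rfl⟩ := hy
    exact hf _ ha _ hb (fun h => hxy (h ▸ rfl))
  · rw [Finset.card_image_of_injOn]
    intro a ha b hb hab
    by_contra hne
    exact (hf _ ha _ hb hne).ne hab

theorem cliqueFree_of_map {V W : Type*} {G : SimpleGraph V} {H : SimpleGraph W} {n : ℕ}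
    (f : V → W) (hf : ∀ u v, G.Adj u v → H.Adj (f u) (f v)) (hH : H.CliqueFree n) :
    G.CliqueFree n := by
  intro S hS
  refine not_cliqueFree_of_image (S := S) f (fun x hx y hy h => hf x y (hS.1 hx hy h)) ?_
  rwa [hS.2]

/-- Ramsey's theorem for colorings of pairs with finitely many colors. -/
theorem exists_monochromatic_subset {K : Type} [Fintype K] (N : ℕ) :
    ∀ k : K → ℕ, ∑ a, k a = N → ∃ p : ℕ, ∀ {V : Type} (c : Sym2 V → K) (S : Finset V),
      p ≤ S.card → ∃ a, ∃ T ⊆ S, T.card = k a ∧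
        (T : Set V).Pairwise fun u v => c s(u, v) = a := by
  induction N with
  | zero =>
    intro k hk
    refine ⟨1, fun {V} c S hS => ?_⟩
    obtain ⟨v, -⟩ := Finset.card_pos.1 hS
    refine ⟨c s(v, v), ∅, by simp, ?_, by simp⟩
    have := Finset.sum_eq_zero_iff.1 hk (c s(v, v)) (Finset.mem_univ _)
    simp [this]
  | succ N ih =>
    intro k hk
    by_cases h0 : ∃ a, k a = 0
    · obtain ⟨a, ha⟩ := h0
      exact ⟨0, fun c S _ => ⟨a, ∅, by simp, by simp [ha], by simp⟩⟩
    push Not at h0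
    have hstep : ∀ a, ∑ b, Function.update k a (k a - 1) b = N := by
      intro a
      have h1 := Finset.sum_update_of_mem (Finset.mem_univ a) k (k a - 1)
      have h2 := Finset.sum_sdiff (Finset.subset_univ {a}) (f := k)
      have := h0 a
      simp only [Finset.sum_singleton] at h2
      omega
    choose p hp using fun a => ih _ (hstep a)
    refine ⟨1 + ∑ a, p a, fun {V} c S hS => ?_⟩
    obtain ⟨v, hv⟩ := Finset.card_pos.1 (show 0 < S.card by omega)
    have hpig : ∃ a, p a ≤ ((S.erase v).filter fun u => c s(v, u) = a).card := by
      by_contra hcon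
      push Not at hcon
      have h1 := Finset.card_eq_sum_card_fiberwise (s := S.erase v) (t := Finset.univ)
        (f := fun u => c s(v, u)) (by intro x _; simp)
      rw [Finset.card_erase_of_mem hv] at h1
      have h2 : Nonempty K := ⟨c s(v, v)⟩
      have h3 := Finset.sum_lt_sum_of_nonempty (Finset.univ_nonempty (α := K))
        (fun a _ => hcon a)
      omega
    obtain ⟨a, ha⟩ := hpig
    obtain ⟨b, T, hTS, hTc, hT⟩ := hp a c _ ha
    have hTS' : T ⊆ S := fun x hx => Finset.mem_of_mem_erase (Finset.mem_filter.1 (hTS hx)).1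
    by_cases hba : b = a
    · subst hba
      have hvT : v ∉ T := fun h => by simpa using hTS h
      refine ⟨b, insert v T, Finset.insert_subset hv hTS', ?_, ?_⟩
      · rw [Finset.card_insert_of_notMem hvT, hTc, Function.update_self]
        have := h0 b
        omega
      · rw [Finset.coe_insert]
        have hv' : ∀ u ∈ T, c s(v, u) = b := fun u hu => (Finset.mem_filter.1 (hTS hu)).2
        exact hT.insert fun u hu _ => ⟨hv' u hu, by rw [Sym2.eq_swap]; exact hv' u hu⟩
    · exact ⟨b, T, hTS', by rw [hTc, Function.update_of_ne hba], hT⟩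

theorem exists_not_cliqueFree_colorGraph_top {K : Type} [Finite K] (s : ℕ) :
    ∃ p : ℕ, ∀ c : Sym2 (Fin p) → K,
      ∃ a, ¬ (colorGraph (⊤ : SimpleGraph (Fin p)) c a).CliqueFree s := by
  have := Fintype.ofFinite K
  obtain ⟨p, hp⟩ := exists_monochromatic_subset (K := K) _ (fun _ => s) rfl
  refine ⟨p, fun c => ?_⟩
  obtain ⟨a, T, -, hTc, hT⟩ := hp c Finset.univ (by simp)
  exact ⟨a, fun h => h T ⟨fun x hx y hy hxy => ⟨hxy, hT hx hy hxy⟩, hTc⟩⟩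

/-- One amalgamation step of the partite construction. -/
theorem exists_partite_mono_over_pair (K : Type) [Finite K] [Nonempty K] {p n : ℕ} {V : Type}
    [Finite V] (G : SimpleGraph V) (π : V → Fin p) (hπ : ∀ u v, G.Adj u v → π u ≠ π v)
    (hn : 3 ≤ n) (hG : G.CliqueFree n) (i j : Fin p) (hij : i ≠ j) :
    ∃ (V' : Type) (_ : Finite V') (G' : SimpleGraph V') (π' : V' → Fin p),
      (∀ u v, G'.Adj u v → π' u ≠ π' v) ∧ G'.CliqueFree n ∧
      ∀ c : Sym2 V' → K, ∃ φ : V → V', (∀ v, π' (φ v) = π v) ∧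
        (∀ u v, G.Adj u v → G'.Adj (φ u) (φ v)) ∧
        ∃ a, ∀ u v, G.Adj u v → π u = i → π v = j → c s(φ u, φ v) = a := by
  let α : Type := {e : V × V // G.Adj e.1 e.2 ∧ π e.1 = i ∧ π e.2 = j}
  obtain ⟨ι, _, hHJ⟩ := Combinatorics.Line.exists_mono_in_high_dimension α K
  let L := Combinatorics.Line α ι
  have : Finite L := Finite.of_injective Combinatorics.Line.idxFun
    (fun x y h => Combinatorics.Line.ext h)
  let V' : Type := Fin p × ((ι → V) ⊕ (L × V))
  let φ : L → V → V' := fun l v => (π v,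
    if π v = i then Sum.inl fun t => (l.idxFun t).elim v fun e => e.1.1
    else if π v = j then Sum.inl fun t => (l.idxFun t).elim v fun e => e.1.2
    else Sum.inr (l, v))
  let G' : SimpleGraph V' :=
    { Adj := fun x y => ∃ l u v, G.Adj u v ∧ x = φ l u ∧ y = φ l v
      symm := ⟨fun x y ⟨l, u, v, h, hx, hy⟩ => ⟨l, v, u, h.symm, hy, hx⟩⟩
      loopless := ⟨fun x ⟨l, u, v, h, hx, hy⟩ =>
        hπ u v h (congrArg Prod.fst (hx.symm.trans hy))⟩ }
  have hG'π : ∀ x y, G'.Adj x y → x.1 ≠ y.1 := by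
    rintro x y ⟨l, u, v, h, rfl, rfl⟩
    exact hπ u v h
  refine ⟨V', inferInstance, G', Prod.fst, hG'π, ?_, ?_⟩
  · intro S hS
    have hout : ∃ z ∈ S, z.1 ≠ i ∧ z.1 ≠ j := by
      by_contra hcon
      push Not at hcon
      have h1 : S.image Prod.fst ⊆ {i, j} := by
        intro k hk
        obtain ⟨z, hz, rfl⟩ := Finset.mem_image.1 hk
        have := hcon z hz
        simp only [Finset.mem_insert, Finset.mem_singleton]
        tauto
      have h2 : (S.image Prod.fst).card = n := by
        rw [Finset.card_image_of_injOn, hS.2]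
        intro x hx y hy hxy
        by_contra hne
        exact hG'π x y (hS.1 hx hy hne) hxy
      have h3 := Finset.card_le_card h1
      have h4 := Finset.card_le_two (a := i) (b := j)
      omega
    obtain ⟨z, hz, hzi, hzj⟩ := hout
    have houter : ∀ l v, π v ≠ i → π v ≠ j → φ l v = (π v, Sum.inr (l, v)) := by
      intro l v h1 h2
      simp [φ, h1, h2]
    obtain ⟨z', hz', hzz'⟩ : ∃ z' ∈ S, z' ≠ z :=
      Finset.exists_mem_ne (by rw [hS.2]; omega) z
    obtain ⟨l, v, v', -, hzv, -⟩ := hS.1 hz hz' hzz'.symm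
    have hline : ∀ q ∈ S, q.1 ≠ i → q.1 ≠ j → ∀ l' u, q = φ l' u → l' = l := by
      intro q hq hqi hqj l' u hqu
      by_cases hqz : q = z
      · subst hqz
        have h1 : φ l' u = φ l v := hqu.symm.trans hzv
        rw [houter l' u (by rw [hqu] at hqi; exact hqi) (by rw [hqu] at hqj; exact hqj),
          houter l v (by rw [hzv] at hqi; exact hqi) (by rw [hzv] at hqj; exact hqj)] at h1
        exact congrArg Prod.fst (Sum.inr.inj (congrArg Prod.snd h1))
      · obtain ⟨l'', u', v'', -, h1, h2⟩ := hS.1 hq hz hqz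
        have h3 : φ l' u = φ l'' u' := hqu.symm.trans h1
        have h4 : φ l v = φ l'' v'' := hzv.symm.trans h2
        rw [houter l' u (by rw [hqu] at hqi; exact hqi) (by rw [hqu] at hqj; exact hqj),
          houter l'' u' (by rw [h1] at hqi; exact hqi) (by rw [h1] at hqj; exact hqj)] at h3
        rw [houter l v (by rw [hzv] at hzi; exact hzi) (by rw [hzv] at hzj; exact hzj),
          houter l'' v'' (by rw [h2] at hzi; exact hzi) (by rw [h2] at hzj; exact hzj)] at h4
        exact (congrArg Prod.fst (Sum.inr.inj (congrArg Prod.snd h3))).trans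
          (congrArg Prod.fst (Sum.inr.inj (congrArg Prod.snd h4))).symm
    obtain ⟨t, ht⟩ := l.proper
    let ρ : V' → V := fun q => Sum.elim (fun f => f t) Prod.snd q.2
    have hρl : ∀ u, ρ (φ l u) = u := by
      intro u
      simp only [ρ, φ]
      split_ifs <;> simp [ht]
    have hρ : ∀ q ∈ S, ∀ q' ∈ S, q ≠ q' → G.Adj (ρ q) (ρ q') := by
      intro q hq q' hq' hne
      obtain ⟨l', a, b, hab, rfl, rfl⟩ := hS.1 hq hq' hne
      by_cases ha : π a ≠ i ∧ π a ≠ j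
      · obtain rfl := hline _ hq ha.1 ha.2 l' a rfl
        rwa [hρl, hρl]
      by_cases hb : π b ≠ i ∧ π b ≠ j
      · obtain rfl := hline _ hq' hb.1 hb.2 l' b rfl
        rwa [hρl, hρl]
      have hne' := hπ a b hab
      have hcases : (π a = i ∧ π b = j) ∨ (π a = j ∧ π b = i) := by grind
      rcases hcases with ⟨h1, h2⟩ | ⟨h1, h2⟩
      · simp only [ρ, φ, h1, h2, if_true, if_neg hij.symm, Sum.elim_inl]
        cases l'.idxFun t with
        | none => exact hab
        | some e => exact e.2.1
      · simp only [ρ, φ, h1, h2, if_true, if_neg hij.symm, Sum.elim_inl]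
        cases l'.idxFun t with
        | none => exact hab
        | some e => exact e.2.1.symm
    exact not_cliqueFree_of_image ρ hρ (hS.2 ▸ hG)
  · intro c
    obtain ⟨l, a, hl⟩ := hHJ fun e => c s((i, Sum.inl fun t => (e t).1.1),
      (j, Sum.inl fun t => (e t).1.2))
    refine ⟨φ l, fun v => rfl, fun u v h => ⟨l, u, v, h, rfl, rfl⟩, a, ?_⟩
    intro u v huv hu hv
    rw [← hl ⟨(u, v), huv, hu, hv⟩]
    simp only [φ, hu, hv, if_true, if_neg hij.symm]
    congr 4
    all_goals
      funext t
      simp only [Combinatorics.Line.coe_apply]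
      cases l.idxFun t <;> rfl

theorem exists_partite_mono_over_pairs (K : Type) [Finite K] [Nonempty K] {p n : ℕ} {V : Type}
    [Finite V] (G : SimpleGraph V) (π : V → Fin p) (hπ : ∀ u v, G.Adj u v → π u ≠ π v)
    (hn : 3 ≤ n) (hG : G.CliqueFree n) (T : Finset (Sym2 (Fin p))) :
    ∃ (V' : Type) (_ : Finite V') (G' : SimpleGraph V') (π' : V' → Fin p),
      (∀ u v, G'.Adj u v → π' u ≠ π' v) ∧ G'.CliqueFree n ∧
      ∀ c : Sym2 V' → K, ∃ φ : V → V', (∀ v, π' (φ v) = π v) ∧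
        (∀ u v, G.Adj u v → G'.Adj (φ u) (φ v)) ∧
        ∃ a : Sym2 (Fin p) → K, ∀ u v, G.Adj u v → s(π u, π v) ∈ T →
          c s(φ u, φ v) = a s(π u, π v) := by
  induction T using Finset.induction_on with
  | empty =>
    refine ⟨V, inferInstance, G, π, hπ, hG, fun c => ⟨id, fun _ => rfl, fun _ _ h => h, ?_⟩⟩
    exact ⟨fun _ => Classical.arbitrary K, by simp⟩
  | insert e T heT ih =>
    obtain ⟨V₁, _, G₁, π₁, hπ₁, hG₁, h₁⟩ := ih
    induction e using Sym2.ind with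
    | _ i j =>
    by_cases hij : i = j
    · refine ⟨V₁, inferInstance, G₁, π₁, hπ₁, hG₁, fun c => ?_⟩
      obtain ⟨φ, hφπ, hφ, a, ha⟩ := h₁ c
      refine ⟨φ, hφπ, hφ, a, fun u v huv hT => ha u v huv ?_⟩
      refine (Finset.mem_insert.1 hT).resolve_left fun h => hπ u v huv ?_
      grind
    · obtain ⟨V₂, hV₂, G₂, π₂, hπ₂, hG₂, h₂⟩ :=
        exists_partite_mono_over_pair K G₁ π₁ hπ₁ hn hG₁ i j hij
      refine ⟨V₂, hV₂, G₂, π₂, hπ₂, hG₂, fun c => ?_⟩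
      obtain ⟨ψ, hψπ, hψ, b, hb⟩ := h₂ c
      obtain ⟨φ, hφπ, hφ, a, ha⟩ := h₁ (c ∘ Sym2.map ψ)
      refine ⟨ψ ∘ φ, fun v => by simp [hψπ, hφπ], fun u v h => hψ _ _ (hφ _ _ h),
        Function.update a s(i, j) b, fun u v huv hT => ?_⟩
      by_cases he : s(π u, π v) = s(i, j)
      · rw [he, Function.update_self]
        rcases Sym2.eq_iff.1 he with ⟨h1, h2⟩ | ⟨h1, h2⟩
        · exact hb _ _ (hφ _ _ huv) (by rw [hφπ, h1]) (by rw [hφπ, h2])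
        · rw [Sym2.eq_swap]
          exact hb _ _ (hφ _ _ huv.symm) (by rw [hφπ, h2]) (by rw [hφπ, h1])
      · rw [Function.update_of_ne he]
        exact ha u v huv ((Finset.mem_insert.1 hT).resolve_left he)

/-- Folkman's theorem for colorings of edges with finitely many colors. -/
theorem exists_cliqueFree_succ_and_mono_clique (K : Type) [Finite K] [Nonempty K] {s : ℕ}
    (hs : 2 ≤ s) :
    ∃ (V : Type) (_ : Finite V) (G : SimpleGraph V), G.CliqueFree (s + 1) ∧
      ∀ c : Sym2 V → K, ∃ a, ¬ (colorGraph G c a).CliqueFree s := by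
  obtain ⟨p, hp⟩ := exists_not_cliqueFree_colorGraph_top (K := K) s
  let G₀ : SimpleGraph ((Fin s ↪ Fin p) × Fin s) :=
    { Adj := fun x y => x.1 = y.1 ∧ x.2 ≠ y.2
      symm := ⟨fun x y h => ⟨h.1.symm, h.2.symm⟩⟩
      loopless := ⟨fun x h => h.2 rfl⟩ }
  have hG₀ : G₀.CliqueFree (s + 1) :=
    cliqueFree_of_map (H := (⊤ : SimpleGraph (Fin s))) Prod.snd (fun u v h => h.2)
      (SimpleGraph.cliqueFree_of_card_lt (by simp))
  obtain ⟨V, hV, G, π, -, hG, h⟩ := exists_partite_mono_over_pairs K G₀ (fun x => x.1 x.2)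
    (by
      rintro ⟨f, x⟩ ⟨g, y⟩ ⟨hfg, hxy⟩ h
      dsimp only at hfg h hxy
      subst hfg
      exact hxy (f.injective h)) (by omega) hG₀ Finset.univ
  refine ⟨V, hV, G, hG, fun c => ?_⟩
  obtain ⟨φ, -, hφ, a, ha⟩ := h c
  obtain ⟨b, hb⟩ := hp a
  refine ⟨b, fun hfree => ?_⟩
  obtain ⟨f⟩ := SimpleGraph.not_cliqueFree_iff_top_isContained s |>.1 hb
  refine cliqueFree_of_map (G := (⊤ : SimpleGraph (Fin s))) (fun x => φ (f.toEmbedding, x)) ?_ hfree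
    Finset.univ ⟨by intro x _ y _ h; exact h, by simp⟩
  intro x y hxy
  have hadj : G₀.Adj (f.toEmbedding, x) (f.toEmbedding, y) := ⟨rfl, hxy⟩
  refine ⟨hφ _ _ hadj, ?_⟩
  rw [ha _ _ hadj (Finset.mem_univ _)]
  exact (f.toHom.map_adj hxy).2

/-- `c` is a coloring of `G` without a clique of size `k b` in any color `b`. -/
def Good {V : Type*} (k : Bool → ℕ) (G : SimpleGraph V) (c : Sym2 V → Bool) : Prop :=
  ∀ b, (colorGraph G c b).CliqueFree (k b)

/-- The pair of clique sizes `l` for red (`true`) and `r` for blue (`false`). -/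
def sizes (l r : ℕ) : Bool → ℕ := fun b => if b then l else r

/-- The edges of `G` inside the classes of the vertex coloring `κ`, with the vertices whose colored
version lies in `Z` isolated. -/
def classGraph {V A : Type*} (G : SimpleGraph V) (κ : V → A) (Z : Finset (V × A)) :
    SimpleGraph V where
  Adj u v := G.Adj u v ∧ κ u = κ v ∧ (u, κ u) ∉ Z ∧ (v, κ v) ∉ Z
  symm := ⟨fun _ _ h => ⟨h.1.symm, h.2.1.symm, h.2.2.2, h.2.2.1⟩⟩
  loopless := ⟨fun u h => G.loopless.irrefl u h.1⟩

theorem exists_cliqueFree_and_classGraph_not_good (A : Type) [Finite A] [Nonempty A] {l s : ℕ}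
    (hls : l ≤ s) (hs : 3 ≤ s) :
    ∃ (V : Type) (_ : Finite V) (G : SimpleGraph V), G.CliqueFree (s + 1) ∧
      ∀ (κ : V → A) (c : Sym2 V → Bool), ¬ Good (sizes l s) (classGraph G κ ∅) c := by
  have : Nonempty (Sym2 A) := ⟨s(Classical.arbitrary A, Classical.arbitrary A)⟩
  obtain ⟨V, hV, G, hG, h⟩ :=
    exists_cliqueFree_succ_and_mono_clique (Sym2 A × Bool) (s := s) (by omega)
  refine ⟨V, hV, G, hG, fun κ c hc => ?_⟩
  obtain ⟨⟨e, b⟩, hb⟩ := h fun x => (x.map κ, c x)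
  simp only [SimpleGraph.CliqueFree, not_forall, not_not] at hb
  obtain ⟨S, hS⟩ := hb
  have hpair : ∀ u ∈ S, ∀ v ∈ S, u ≠ v → G.Adj u v ∧ s(κ u, κ v) = e ∧ c s(u, v) = b := by
    intro u hu v hv huv
    have := hS.1 hu hv huv
    exact ⟨this.1, congrArg Prod.fst this.2, congrArg Prod.snd this.2⟩
  have hκ : ∀ u ∈ S, ∀ v ∈ S, u ≠ v → κ u = κ v := by
    intro u hu v hv huv
    obtain ⟨w, hw⟩ : ((S.erase u).erase v).Nonempty := by
      rw [← Finset.card_pos, Finset.card_erase_of_mem (by simp [hv, huv.symm]),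
        Finset.card_erase_of_mem hu, hS.2]
      omega
    simp only [Finset.mem_erase] at hw
    have h1 := (hpair u hu v hv huv).2.1
    have h2 := (hpair u hu w hw.2.2 hw.2.1.symm).2.1
    have h3 := (hpair v hv w hw.2.2 hw.1.symm).2.1
    subst h1
    rw [Sym2.eq_iff] at h2 h3
    grind
  have hk : sizes l s b ≤ S.card := by
    rw [hS.2]
    cases b <;> simp [sizes, hls]
  refine not_cliqueFree_of_image (S := S) id (fun u hu v hv huv => ?_) ((hc b).mono hk)
  have := hpair u hu v hv huv
  exact ⟨⟨this.1, hκ u hu v hv huv, by simp, by simp⟩, this.2.2⟩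

/-- The complete graph with the vertex `u` isolated. -/
def topMinus {A : Type*} (u : A) : SimpleGraph A where
  Adj i j := i ≠ j ∧ i ≠ u ∧ j ≠ u
  symm := ⟨fun _ _ h => ⟨h.1.symm, h.2.2, h.2.1⟩⟩
  loopless := ⟨fun _ h => h.1 rfl⟩

theorem exists_vertex_critical_top (k : Bool → ℕ) (hk : ∀ b, 2 ≤ k b) :
    ∃ m : ℕ, 0 < m ∧ (∀ c : Sym2 (Fin m) → Bool, ¬ Good k ⊤ c) ∧
      ∀ u : Fin m, ∃ c, Good k (topMinus u) c := by
  have hex : ∃ m : ℕ, ∀ c : Sym2 (Fin m) → Bool, ¬ Good k ⊤ c := by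
    obtain ⟨p, hp⟩ := exists_not_cliqueFree_colorGraph_top (K := Bool) (max (k true) (k false))
    refine ⟨p, fun c hc => ?_⟩
    obtain ⟨b, hb⟩ := hp c
    exact hb ((hc b).mono (by cases b <;> simp))
  have hmin := fun n => Nat.find_min (m := n) hex
  have hfind := Nat.find_spec hex
  generalize Nat.find hex = m at hmin hfind
  rcases m with _ | _ | m
  · refine (hfind (fun _ => true) fun b => ?_).elim
    exact SimpleGraph.cliqueFree_of_card_lt (by have := hk b; simp; omega)
  · refine (hfind (fun _ => true) fun b => ?_).elim
    exact SimpleGraph.cliqueFree_of_card_lt (by have := hk b; simp; omega)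
  · refine ⟨m + 1 + 1, by omega, hfind, fun u => ?_⟩
    have h := hmin (m + 1) (by omega)
    push Not at h
    obtain ⟨c, hc⟩ := h
    let g : Fin (m + 1 + 1) → Fin (m + 1) := fun i => (finSuccEquiv' u i).getD 0
    refine ⟨c ∘ Sym2.map g, fun b => cliqueFree_of_map g ?_ (hc b)⟩
    rintro i j ⟨⟨hij, hi, hj⟩, hcol⟩
    refine ⟨?_, hcol⟩
    obtain ⟨i, rfl⟩ := Fin.exists_succAbove_eq hi
    obtain ⟨j, rfl⟩ := Fin.exists_succAbove_eq hj
    simpa [g] using hij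

/-- A cone over the disjoint cliques `{v} × A`, together with one copy of `G` for every element
of `A`, where the vertices in `Z` are isolated in these copies. -/
def coneGraph {V A : Type*} (G : SimpleGraph V) (Z : Finset (V × A)) :
    SimpleGraph (Option (V × A)) where
  Adj
    | none, none => False
    | none, some _ => True
    | some _, none => True
    | some p, some q =>
      (p.1 = q.1 ∧ p.2 ≠ q.2) ∨ (G.Adj p.1 q.1 ∧ p.2 = q.2 ∧ p ∉ Z ∧ q ∉ Z)
  symm := ⟨by
    rintro (_ | p) (_ | q) h
    · exact h
    · trivial
    · trivial
    · rcases h with h | h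
      · exact Or.inl ⟨h.1.symm, h.2.symm⟩
      · exact Or.inr ⟨h.1.symm, h.2.1.symm, h.2.2.2, h.2.2.1⟩⟩
  loopless := ⟨by
    rintro (_ | p) h
    · exact h
    · rcases h with h | h
      · exact h.2 rfl
      · exact G.loopless.irrefl _ h.1⟩

theorem not_cliqueFree_succ_of_cone {V W : Type*} {G : SimpleGraph W} {H : SimpleGraph V} {n : ℕ}
    (hG : ¬ G.CliqueFree n) (v : V) (f : W → V) (hf : ∀ x y, G.Adj x y → H.Adj (f x) (f y))
    (hv : ∀ x, H.Adj v (f x)) : ¬ H.CliqueFree (n + 1) := by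
  simp only [SimpleGraph.CliqueFree, not_forall, not_not] at hG
  obtain ⟨S, hS⟩ := hG
  rw [← hS.2, ← Finset.card_insertNone]
  refine not_cliqueFree_of_image (fun x : Option W => x.elim v f) ?_
  rintro (_ | x) hx (_ | y) hy hxy
  · exact (hxy rfl).elim
  · exact hv y
  · exact (hv x).symm
  · exact hf _ _ (hS.1 (Finset.some_mem_insertNone.1 hx) (Finset.some_mem_insertNone.1 hy)
      (fun h => hxy (h ▸ rfl)))

theorem coneGraph_forces_blue {V A : Type*} [DecidableEq V] [DecidableEq A] {G : SimpleGraph V}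
    {Z : Finset (V × A)} {u : V × A} {l s : ℕ}
    (hA : ∀ c : Sym2 A → Bool, ¬ Good (sizes l (s + 1)) ⊤ c)
    (hZ : ∀ (κ : V → A) (c : Sym2 V → Bool), ¬ Good (sizes (l + 1) s) (classGraph G κ Z) c)
    {c : Sym2 (Option (V × A)) → Bool}
    (hc : Good (sizes (l + 1) (s + 1)) (coneGraph G (insert u Z)) c) :
    c s(none, some u) = false := by
  have hblue : ∀ v, ∃ a, c s(none, some (v, a)) = false := by
    intro v
    by_contra hcon
    push Not at hcon
    simp only [ne_eq, Bool.not_eq_false] at hcon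
    have := hA (c ∘ Sym2.map fun a => some (v, a))
    simp only [Good, not_forall] at this
    obtain ⟨b, hb⟩ := this
    have hmap : ∀ x y : A, (colorGraph ⊤ (c ∘ Sym2.map fun a => some (v, a)) b).Adj x y →
        (colorGraph (coneGraph G (insert u Z)) c b).Adj (some (v, x)) (some (v, y)) :=
      fun x y h => ⟨Or.inl ⟨rfl, h.1⟩, h.2⟩
    cases b with
    | true =>
      exact not_cliqueFree_succ_of_cone hb none (fun a => some (v, a)) hmap
        (fun a => ⟨trivial, hcon a⟩) (hc true)
    | false => exact hb (cliqueFree_of_map (fun a => some (v, a)) hmap (hc false))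
  by_contra hu
  choose κ hκ using hblue
  have hne : ∀ v, (v, κ v) ≠ u := fun v h => hu (h ▸ hκ v)
  have := hZ κ (c ∘ Sym2.map fun v => some (v, κ v))
  simp only [Good, not_forall] at this
  obtain ⟨b, hb⟩ := this
  have hmap : ∀ x y : V,
      (colorGraph (classGraph G κ Z) (c ∘ Sym2.map fun v => some (v, κ v)) b).Adj x y →
      (colorGraph (coneGraph G (insert u Z)) c b).Adj (some (x, κ x)) (some (y, κ y)) :=
    fun x y h => ⟨Or.inr ⟨h.1.1, h.1.2.1, by simp [hne, h.1.2.2.1], by simp [hne, h.1.2.2.2]⟩, h.2⟩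
  cases b with
  | true => exact hb (cliqueFree_of_map _ hmap (hc true))
  | false =>
    exact not_cliqueFree_succ_of_cone hb none _ hmap (fun v => ⟨trivial, hκ v⟩) (hc false)

/-- The coloring of the cone graph assembled from a transversal `κ`, a coloring `c₀` of the
transversal and colorings `τ` of the cliques. -/
noncomputable def coneColoring {V A : Type*} (κ : V → A) (c₀ : Sym2 V → Bool)
    (τ : A → Sym2 A → Bool) : Sym2 (Option (V × A)) → Bool :=
  Sym2.lift ⟨fun x y => match x, y with
    | none, none => true
    | none, some p => decide (p.2 ≠ κ p.1)
    | some p, none => decide (p.2 ≠ κ p.1)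
    | some p, some q =>
      if p.1 = q.1 then
        if p.2 = κ p.1 ∨ q.2 = κ q.1 then true else τ (κ p.1) s(p.2, q.2)
      else if p.2 = κ p.1 ∧ q.2 = κ q.1 then c₀ s(p.1, q.1) else false, by
    rintro (_ | p) (_ | q)
    · rfl
    · rfl
    · rfl
    · dsimp only
      rw [Sym2.eq_swap (a := p.2), Sym2.eq_swap (a := p.1)]
      grind⟩

theorem good_coneColoring {V A : Type*} {G : SimpleGraph V} {Z : Finset (V × A)} {l s : ℕ}
    (hl : 2 ≤ l) (hs : 2 ≤ s) (hG : G.CliqueFree (s + 1)) {κ : V → A} {c₀ : Sym2 V → Bool}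
    (hc₀ : Good (sizes (l + 1) s) (classGraph G κ Z) c₀) {τ : A → Sym2 A → Bool}
    (hτ : ∀ a, Good (sizes l (s + 1)) (topMinus a) (τ a)) :
    Good (sizes (l + 1) (s + 1)) (coneGraph G Z) (coneColoring κ c₀ τ) := by
  intro b S hS
  have hnone : ∀ p, some p ∈ S → none ∈ S → decide (p.2 ≠ κ p.1) = b :=
    fun p hp hn => (hS.1 hn hp (by simp)).2
  have hsome : ∀ p q, some p ∈ S → some q ∈ S → p ≠ q →
      ((p.1 = q.1 ∧ p.2 ≠ q.2) ∨ (G.Adj p.1 q.1 ∧ p.2 = q.2 ∧ p ∉ Z ∧ q ∉ Z)) ∧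
      (if p.1 = q.1 then
        if p.2 = κ p.1 ∨ q.2 = κ q.1 then true else τ (κ p.1) s(p.2, q.2)
      else if p.2 = κ p.1 ∧ q.2 = κ q.1 then c₀ s(p.1, q.1) else false) = b :=
    fun p q hp hq hpq => hS.1 hp hq (fun h => hpq (Option.some.inj h))
  have hcardlt : 2 < S.card := by
    rw [hS.2]
    cases b <;> simp [sizes] <;> omega
  obtain ⟨x₀, hx₀, hx₀n⟩ := Finset.exists_mem_ne (show 1 < S.card by omega) none
  obtain ⟨p₀, rfl⟩ := Option.ne_none_iff_exists'.1 hx₀n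
  let fst : Option (V × A) → V := fun x => (x.getD p₀).1
  let snd : Option (V × A) → A := fun x => (x.getD p₀).2
  cases b with
  | true =>
    have hScard : S.card = l + 1 := hS.2
    by_cases hn : none ∈ S
    · have hcard : (S.erase none).card = l := by rw [Finset.card_erase_of_mem hn]; omega
      refine not_cliqueFree_of_image (S := S.erase none) (H := colorGraph (topMinus (κ p₀.1))
        (τ (κ p₀.1)) true) snd ?_ (hcard ▸ hτ (κ p₀.1) true)
      rintro (_ | p) hp (_ | q) hq hpq
      · simp at hp
      · simp at hp
      · simp at hq
      simp only [Finset.mem_erase, ne_eq, reduceCtorEq, not_false_eq_true, true_and] at hp hq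
      have h1 := hnone p hp hn
      have h2 := hnone q hq hn
      have h3 := hsome p q hp hq (fun h => hpq (h ▸ rfl))
      have h4 := hnone p₀ hx₀ hn
      have h5 := hsome p p₀ hp hx₀
      simp only [decide_eq_true_eq] at h1 h2 h4
      simp only [snd, Option.getD_some, colorGraph, topMinus]
      grind
    · by_cases hall : ∀ p q, some p ∈ S → some q ∈ S → p.1 = q.1
      · have hcard : l ≤ (S.erase (some (p₀.1, κ p₀.1))).card := by
          have := Finset.pred_card_le_card_erase (s := S) (a := some (p₀.1, κ p₀.1))
          omega
        refine not_cliqueFree_of_image (S := S.erase (some (p₀.1, κ p₀.1)))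
          (H := colorGraph (topMinus (κ p₀.1)) (τ (κ p₀.1)) true) snd ?_
          ((hτ (κ p₀.1) true).mono hcard)
        rintro (_ | p) hp (_ | q) hq hpq
        · exact (hpq rfl).elim
        · exact (hn (Finset.mem_of_mem_erase hp)).elim
        · exact (hn (Finset.mem_of_mem_erase hq)).elim
        simp only [Finset.mem_erase, ne_eq, Option.some.injEq] at hp hq
        have h1 := hall p p₀ hp.2 hx₀
        have h2 := hall q p₀ hq.2 hx₀
        have h3 := hsome p q hp.2 hq.2 (fun h => hpq (h ▸ rfl))
        have h4 : p.2 ≠ κ p₀.1 := fun h => hp.1 (Prod.ext h1 h)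
        have h5 : q.2 ≠ κ p₀.1 := fun h => hq.1 (Prod.ext h2 h)
        simp only [snd, Option.getD_some, colorGraph, topMinus]
        grind
      · push Not at hall
        obtain ⟨p, q, hp, hq, hpq⟩ := hall
        have htrans : ∀ y, some y ∈ S → y.2 = κ y.1 := by
          intro y hy
          have h1 := hsome y p hy hp
          have h2 := hsome y q hy hq
          grind
        refine not_cliqueFree_of_image (S := S)
          (H := colorGraph (classGraph G κ Z) c₀ true) fst ?_ (hScard ▸ hc₀ true)
        rintro (_ | x) hx (_ | y) hy hxy
        · exact (hxy rfl).elim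
        · exact (hn hx).elim
        · exact (hn hy).elim
        have h1 := hsome x y hx hy (fun h => hxy (h ▸ rfl))
        have h2 := htrans x hx
        have h3 := htrans y hy
        obtain ⟨x, a⟩ := x
        obtain ⟨y, a'⟩ := y
        dsimp only at h2 h3
        subst h2 h3
        simp only [fst, Option.getD_some, colorGraph, classGraph]
        grind
  | false =>
    have hScard : S.card = s + 1 := hS.2
    by_cases hn : none ∈ S
    · have hcard : (S.erase none).card = s := by rw [Finset.card_erase_of_mem hn]; omega
      refine not_cliqueFree_of_image (S := S.erase none)
        (H := colorGraph (classGraph G κ Z) c₀ false) fst ?_ (hcard ▸ hc₀ false)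
      rintro (_ | x) hx (_ | y) hy hxy
      · simp at hx
      · simp at hx
      · simp at hy
      simp only [Finset.mem_erase, ne_eq, reduceCtorEq, not_false_eq_true, true_and] at hx hy
      have h1 := hsome x y hx hy (fun h => hxy (h ▸ rfl))
      have h2 := hnone x hx hn
      have h3 := hnone y hy hn
      simp only [ne_eq, decide_eq_false_iff_not, not_not] at h2 h3
      obtain ⟨x, a⟩ := x
      obtain ⟨y, a'⟩ := y
      dsimp only at h2 h3
      subst h2 h3
      simp only [fst, Option.getD_some, colorGraph, classGraph]
      grind
    · by_cases hpair : ∃ p q, some p ∈ S ∧ some q ∈ S ∧ p ≠ q ∧ p.1 = q.1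
      · obtain ⟨p, q, hp, hq, hpq, hpq1⟩ := hpair
        have hblock : ∀ y, some y ∈ S → y.1 = p.1 := by
          intro y hy
          by_contra h
          have h1 := (hsome y p hy hp fun e => h (e ▸ rfl)).1.resolve_left fun e => h e.1
          have h2 := (hsome y q hy hq fun e => h (e ▸ hpq1.symm)).1.resolve_left
            fun e => h (e.1.trans hpq1.symm)
          exact hpq (Prod.ext hpq1 (h1.2.1.symm.trans h2.2.1))
        refine not_cliqueFree_of_image (S := S) (H := colorGraph (topMinus (κ p.1))
          (τ (κ p.1)) false) snd ?_ (hScard ▸ hτ (κ p.1) false)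
        rintro (_ | x) hx (_ | y) hy hxy
        · exact (hxy rfl).elim
        · exact (hn hx).elim
        · exact (hn hy).elim
        have h1 := hsome x y hx hy (fun h => hxy (h ▸ rfl))
        have h2 := hblock x hx
        have h3 := hblock y hy
        simp only [snd, Option.getD_some, colorGraph, topMinus]
        grind
      · push Not at hpair
        refine not_cliqueFree_of_image (S := S) (H := G) fst ?_ (hScard ▸ hG)
        rintro (_ | x) hx (_ | y) hy hxy
        · exact (hxy rfl).elim
        · exact (hn hx).elim
        · exact (hn hy).elim
        have hne : x ≠ y := fun h => hxy (h ▸ rfl)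
        have h1 := (hsome x y hx hy hne).1
        exact (h1.resolve_left fun h => hpair x y hx hy hne h.1).1

/-- There is a graph with an edge that is blue in all its good colorings. -/
theorem exists_forced_blue_edge {l r : ℕ} (hl : 3 ≤ l) (hlr : l < r) :
    ∃ (V : Type) (_ : Finite V) (D : SimpleGraph V) (x y : V), D.Adj x y ∧
      (∃ c, Good (sizes l r) D c) ∧ ∀ c, Good (sizes l r) D c → c s(x, y) = false := by
  obtain ⟨l, rfl⟩ : ∃ l', l = l' + 1 := ⟨l - 1, by omega⟩
  obtain ⟨s, rfl⟩ : ∃ s, r = s + 1 := ⟨r - 1, by omega⟩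
  obtain ⟨m, hm, hA, hcrit⟩ := exists_vertex_critical_top (sizes l (s + 1))
    (by intro b; cases b <;> simp [sizes] <;> omega)
  have : Nonempty (Fin m) := ⟨⟨0, hm⟩⟩
  obtain ⟨V, hV, G, hG, hκ⟩ :=
    exists_cliqueFree_and_classGraph_not_good (Fin m) (l := l + 1) (s := s) (by omega) (by omega)
  have := Fintype.ofFinite V
  choose τ hτ using hcrit
  obtain ⟨Z, u, hZ, hZu⟩ : ∃ (Z : Finset (V × Fin m)) (u : V × Fin m),
      (∀ (κ : V → Fin m) (c : Sym2 V → Bool), ¬ Good (sizes (l + 1) s) (classGraph G κ Z) c) ∧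
      ∃ (κ : V → Fin m) (c : Sym2 V → Bool),
        Good (sizes (l + 1) s) (classGraph G κ (insert u Z)) c := by
    by_contra hcon
    push Not at hcon
    have hall : ∀ Z : Finset (V × Fin m), ∀ (κ : V → Fin m) (c : Sym2 V → Bool),
        ¬ Good (sizes (l + 1) s) (classGraph G κ Z) c := by
      intro Z
      induction Z using Finset.induction_on with
      | empty => exact hκ
      | insert u Z _ ih => exact hcon Z u ih
    refine hall Finset.univ (fun _ => ⟨0, hm⟩) (fun _ => true) fun b S hS => ?_
    have hcard : 1 < S.card := by
      rw [hS.2]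
      cases b <;> simp [sizes] <;> omega
    obtain ⟨x, hx, y, hy, hxy⟩ := Finset.one_lt_card.1 hcard
    exact (hS.1 hx hy hxy).1.2.2.1 (Finset.mem_univ _)
  obtain ⟨κ, c₀, hc₀⟩ := hZu
  exact ⟨Option (V × Fin m), inferInstance, coneGraph G (insert u Z), none, some u, trivial,
    ⟨_, good_coneColoring (by omega) (by omega) hG hc₀ hτ⟩,
    fun c hc => coneGraph_forces_blue hA hZ hc⟩

theorem Good.mono {V : Type*} {k : Bool → ℕ} {G H : SimpleGraph V} (h : H ≤ G)
    {c : Sym2 V → Bool} (hc : Good k G c) : Good k H c :=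
  fun b => SimpleGraph.CliqueFree.anti (H := colorGraph G c b)
    (fun _ _ huv => ⟨h huv.1, huv.2⟩) (hc b)

theorem Good.comap {V W : Type*} {k : Bool → ℕ} {G : SimpleGraph V} {c : Sym2 V → Bool}
    (hc : Good k G c) (f : W → V) : Good k (G.comap f) (c ∘ Sym2.map f) :=
  fun b => cliqueFree_of_map (H := colorGraph G c b) f (fun _ _ h => ⟨h.1, h.2⟩) (hc b)

section Glue

variable {V B : Type} (D : SimpleGraph V) (x y : V) (S : Set (B × B))

/-- The inclusion of the copy of `V` attached to the pair `i`, with `x` and `y` placed at the two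
entries of `i`. -/
noncomputable def glueMap (i : B × B) (v : V) : B ⊕ ((B × B) × V) :=
  if v = x then .inl i.1 else if v = y then .inl i.2 else .inr (i, v)

/-- A left inverse of `glueMap`. -/
noncomputable def unglue (i : B × B) : B ⊕ ((B × B) × V) → V
  | .inl a => if a = i.1 then x else y
  | .inr p => p.2

/-- The complete graph on `B`, with a copy of `D` attached along the edge `x y` to every pair
in `S`. -/
def glueGraph : SimpleGraph (B ⊕ ((B × B) × V)) where
  Adj u w := u ≠ w ∧ ((∃ a b, u = .inl a ∧ w = .inl b) ∨
    ∃ i ∈ S, ∃ v v', D.Adj v v' ∧ u = glueMap x y i v ∧ w = glueMap x y i v')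
  symm := ⟨by
    rintro u w ⟨hne, ⟨a, b, ha, hb⟩ | ⟨i, hi, v, v', h, hv, hv'⟩⟩
    · exact ⟨hne.symm, .inl ⟨b, a, hb, ha⟩⟩
    · exact ⟨hne.symm, .inr ⟨i, hi, v', v, h.symm, hv', hv⟩⟩⟩
  loopless := ⟨fun _ h => h.1 rfl⟩

variable {D x y S}

theorem unglue_glueMap {i : B × B} (hi : i.1 ≠ i.2) (v : V) :
    unglue x y i (glueMap x y i v) = v := by
  unfold glueMap
  split_ifs with h1 h2
  · simp [unglue, h1]
  · simp [unglue, h2, hi.symm]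
  · rfl

theorem glueMap_injective {i : B × B} (hi : i.1 ≠ i.2) :
    Function.Injective (glueMap x y i) :=
  Function.LeftInverse.injective (unglue_glueMap hi)

theorem glueGraph_adj_inr (hS : ∀ i ∈ S, i.1 ≠ i.2) {i : B × B} {v : V} {w : B ⊕ ((B × B) × V)}
    (h : (glueGraph D x y S).Adj (.inr (i, v)) w) :
    i ∈ S ∧ D.Adj v (unglue x y i w) ∧ glueMap x y i v = .inr (i, v) ∧
      glueMap x y i (unglue x y i w) = w := by
  obtain ⟨-, ⟨a, b, ha, -⟩ | ⟨j, hj, v₁, v', hv, h1, rfl⟩⟩ := h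
  · simp at ha
  · have : j = i ∧ v₁ = v := by
      unfold glueMap at h1
      split_ifs at h1
      simpa [eq_comm] using h1
    obtain ⟨rfl, rfl⟩ := this
    rw [unglue_glueMap (hS j hj)]
    exact ⟨hj, hv, h1.symm, rfl⟩

theorem comap_glueMap_le (hS : ∀ i ∈ S, i.1 ≠ i.2) (hxy : D.Adj x y) {i : B × B} (hi : i ∈ S) :
    (glueGraph D x y S).comap (glueMap x y i) ≤ D := by
  have hinr : ∀ v, v ≠ x → v ≠ y → glueMap x y i v = .inr (i, v) := by
    intro v h1 h2
    simp [glueMap, h1, h2]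
  intro v w h
  have hne : v ≠ w := h.ne
  rw [SimpleGraph.comap_adj] at h
  by_cases hv : v = x ∨ v = y
  · by_cases hw : w = x ∨ w = y
    · have := hxy.symm
      grind
    · push Not at hw
      have h' := h.symm
      rw [hinr w hw.1 hw.2] at h'
      have := (glueGraph_adj_inr hS h').2.1
      rw [unglue_glueMap (hS i hi)] at this
      exact this.symm
  · push Not at hv
    rw [hinr v hv.1 hv.2] at h
    have := (glueGraph_adj_inr hS h).2.1
    rwa [unglue_glueMap (hS i hi)] at this

theorem le_comap_glueMap (hS : ∀ i ∈ S, i.1 ≠ i.2) {i : B × B} (hi : i ∈ S) :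
    D ≤ (glueGraph D x y S).comap (glueMap x y i) :=
  fun v w h => ⟨(glueMap_injective (hS i hi)).ne h.ne, .inr ⟨i, hi, v, w, h, rfl, rfl⟩⟩

theorem glueMap_left (i : B × B) : glueMap x y i x = .inl i.1 := by simp [glueMap]

theorem glueMap_right (hxy : x ≠ y) (i : B × B) : glueMap x y i y = .inl i.2 := by
  simp [glueMap, hxy.symm]

/-- The coloring of the glued graph assembled from a coloring of the base and colorings of the
copies. -/
noncomputable def glueColoring (x y : V) (β : Sym2 B → Bool) (χ : B × B → Sym2 V → Bool) :
    Sym2 (B ⊕ ((B × B) × V)) → Bool :=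
  Sym2.lift ⟨fun u w => match u, w with
    | .inl a, .inl b => β s(a, b)
    | .inl a, .inr p => χ p.1 s(unglue x y p.1 (.inl a), p.2)
    | .inr p, .inl a => χ p.1 s(unglue x y p.1 (.inl a), p.2)
    | .inr p, .inr p' => if p.1 = p'.1 then χ p.1 s(p.2, p'.2) else true, by
    rintro (a | p) (b | p')
    · dsimp only
      rw [Sym2.eq_swap]
    · rfl
    · rfl
    · dsimp only
      rw [Sym2.eq_swap]
      grind⟩

theorem good_glueColoring {k : Bool → ℕ} (hk : ∀ b, 2 ≤ k b) (hS : ∀ i ∈ S, i.1 ≠ i.2)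
    {H : SimpleGraph (B ⊕ ((B × B) × V))} (hH : H ≤ glueGraph D x y S)
    {β : Sym2 B → Bool} (hβ : Good k (H.comap Sum.inl) β) {χ : B × B → Sym2 V → Bool}
    (hχ : ∀ i ∈ S, Good k (H.comap (glueMap x y i)) (χ i))
    (heq : ∀ i ∈ S, χ i s(x, y) = β s(i.1, i.2)) : Good k H (glueColoring x y β χ) := by
  intro b T hT
  by_cases hinr : ∃ p, Sum.inr p ∈ T
  · obtain ⟨⟨i, v⟩, hp⟩ := hinr
    obtain ⟨w, hw, hwne⟩ := Finset.exists_mem_ne (show 1 < T.card by rw [hT.2]; exact hk b)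
      (.inr (i, v))
    have hwv := glueGraph_adj_inr hS (hH (hT.1 hp hw hwne.symm).1)
    have hi := hwv.1
    have hmem : ∀ u ∈ T, glueMap x y i (unglue x y i u) = u := by
      intro u hu
      by_cases huv : u = .inr (i, v)
      · rw [huv]
        exact hwv.2.2.1
      · exact (glueGraph_adj_inr hS (hH (hT.1 hp hu (Ne.symm huv)).1)).2.2.2
    have hfst : ∀ p, Sum.inr p ∈ T → p.1 = i := by
      intro p hp'
      have := hmem _ hp'
      unfold glueMap at this
      split_ifs at this
      exact congrArg Prod.fst (Sum.inr.inj this).symm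
    have hbase : ∀ a, Sum.inl a ∈ T → a = i.1 ∨ a = i.2 := by
      intro a ha
      have := hmem _ ha
      unfold glueMap at this
      split_ifs at this
      · exact .inl (Sum.inl.inj this).symm
      · exact .inr (Sum.inl.inj this).symm
    refine not_cliqueFree_of_image (S := T) (unglue x y i) ?_ (hT.2 ▸ hχ i hi b)
    intro u hu u' hu' hne
    have hadj := hT.1 hu hu' hne
    refine ⟨?_, ?_⟩
    · rw [SimpleGraph.comap_adj, hmem u hu, hmem u' hu']
      exact hadj.1
    · rw [← hadj.2]
      have hχs : χ i s(y, x) = χ i s(x, y) := by rw [Sym2.eq_swap]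
      have hβs : β s(i.2, i.1) = β s(i.1, i.2) := by rw [Sym2.eq_swap]
      have := heq i hi
      have hi' := hS i hi
      rcases u with a | p <;> rcases u' with a' | p'
      · have h1 := hbase a hu
        have h2 := hbase a' hu'
        simp only [glueColoring, Sym2.lift_mk, unglue]
        grind
      · have h1 := hfst p' hu'
        subst h1
        rfl
      · have h1 := hfst p hu
        subst h1
        rw [Sym2.eq_swap]
        rfl
      · have h1 := hfst p hu
        have h2 := hfst p' hu'
        subst h1
        simp [glueColoring, unglue, h2]
  · push Not at hinr
    have : Nonempty B := by
      obtain ⟨u, hu⟩ : T.Nonempty := by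
        rw [← Finset.card_pos, hT.2]
        exact lt_of_lt_of_le two_pos (hk b)
      rcases u with a | p
      · exact ⟨a⟩
      · exact (hinr p hu).elim
    refine not_cliqueFree_of_image (S := T) (Sum.elim id fun _ => Classical.arbitrary B) ?_
      (hT.2 ▸ hβ b)
    rintro (a | p) hu (a' | p') hu' hne
    · exact hT.1 hu hu' hne
    · exact (hinr _ hu').elim
    · exact (hinr _ hu).elim
    · exact (hinr _ hu).elim

end Glue

/-- The edge `x y` has color `b` in all good colorings of `D`, but this fails for every subgraph
of `D` with at most `n` edges. -/
structure Forces {V : Type} (k : Bool → ℕ) (n : ℕ) (b : Bool) (D : SimpleGraph V) (x y : V) :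
    Prop where
  adj : D.Adj x y
  exists_good : ∃ c, Good k D c
  eq_of_good : ∀ c, Good k D c → c s(x, y) = b
  robust : ∀ H ≤ D, H.edgeSet.ncard ≤ n → ∃ c, Good k H c ∧ c s(x, y) ≠ b

theorem Forces.exists_good_glueGraph {V B : Type} {k : Bool → ℕ} {n : ℕ} {b : Bool}
    {D : SimpleGraph V} {x y : V} {S : Set (B × B)} (hD : Forces k n b D x y)
    (hk : ∀ b, 2 ≤ k b) (hS : ∀ i ∈ S, i.1 ≠ i.2) {H : SimpleGraph (B ⊕ ((B × B) × V))}
    (hH : H ≤ glueGraph D x y S) {β : Sym2 B → Bool} (hβ : Good k (H.comap Sum.inl) β)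
    (hn : ∀ i ∈ S, β s(i.1, i.2) ≠ b → (H.comap (glueMap x y i)).edgeSet.ncard ≤ n) :
    ∃ c, Good k H c ∧ ∀ a a', c s(.inl a, .inl a') = β s(a, a') := by
  have hle : ∀ i ∈ S, H.comap (glueMap x y i) ≤ D := fun i hi =>
    le_trans (fun _ _ h => hH h) (comap_glueMap_le hS hD.adj hi)
  have hχ : ∀ i : B × B, ∃ χ, i ∈ S →
      Good k (H.comap (glueMap x y i)) χ ∧ χ s(x, y) = β s(i.1, i.2) := by
    intro i
    by_cases hi : i ∈ S
    · by_cases hb : β s(i.1, i.2) = b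
      · obtain ⟨c, hc⟩ := hD.exists_good
        exact ⟨c, fun _ => ⟨hc.mono (hle i hi), (hD.eq_of_good c hc).trans hb.symm⟩⟩
      · obtain ⟨c, hc, hcb⟩ := hD.robust _ (hle i hi) (hn i hi hb)
        exact ⟨c, fun _ => ⟨hc, by rw [Bool.eq_not_of_ne hcb, Bool.eq_not_of_ne hb]⟩⟩
    · exact ⟨fun _ => true, fun h => (hi h).elim⟩
  choose χ hχ using hχ
  exact ⟨glueColoring x y β χ, good_glueColoring hk hS hH hβ (fun i hi => (hχ i hi).1)
    (fun i hi => (hχ i hi).2), fun _ _ => rfl⟩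

theorem Forces.eq_of_good_glueGraph {V B : Type} {k : Bool → ℕ} {n : ℕ} {b : Bool}
    {D : SimpleGraph V} {x y : V} {S : Set (B × B)} (hD : Forces k n b D x y)
    (hS : ∀ i ∈ S, i.1 ≠ i.2) {c : Sym2 (B ⊕ ((B × B) × V)) → Bool}
    (hc : Good k (glueGraph D x y S) c) {i : B × B} (hi : i ∈ S) :
    c s(.inl i.1, .inl i.2) = b := by
  have := hD.eq_of_good _ ((hc.comap (glueMap x y i)).mono (le_comap_glueMap hS hi))
  simpa [glueMap_left, glueMap_right hD.adj.ne] using this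

theorem good_of_eq_outside_edge {k : Bool → ℕ} {b : Bool} (hk : ∀ b, 3 ≤ k b)
    (K : SimpleGraph (Fin (k b))) {β : Sym2 (Fin (k b)) → Bool} {a a' : Fin (k b)} (hne : a ≠ a')
    (hβ : ∀ e, β e ≠ b → e = s(a, a')) (h : β s(a, a') ≠ b ∨ ¬ K.Adj a a') : Good k K β := by
  intro d T hT
  by_cases hd : d = b
  · subst hd
    have huniv : T = Finset.univ := by
      rw [← Finset.card_eq_iff_eq_univ, hT.2, Fintype.card_fin]
    have := hT.1 (x := a) (y := a') (by simp [huniv]) (by simp [huniv]) hne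
    exact h.elim (fun h => h this.2) fun h => h this.1
  · have hcard : 2 < T.card := by
      rw [hT.2]
      exact hk d
    obtain ⟨u, v, w, hu, hv, hw, huv, huw, hvw⟩ := Finset.two_lt_card_iff.1 hcard
    have h1 := hβ s(u, v) (by rw [(hT.1 hu hv huv).2]; exact hd)
    have h2 := hβ s(u, w) (by rw [(hT.1 hu hw huw).2]; exact hd)
    have h3 := h1.trans h2.symm
    simp only [Sym2.eq_iff] at h3
    grind

theorem ncard_edgeSet_comap_le {V W : Type*} {G : SimpleGraph V} {f : W → V}
    (hf : Function.Injective f) {T : Set (Sym2 V)} (hT : T.Finite)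
    (h : ∀ u v, G.Adj (f u) (f v) → s(f u, f v) ∈ T) : (G.comap f).edgeSet.ncard ≤ T.ncard := by
  refine Set.ncard_le_ncard_of_injOn (Sym2.map f) ?_ (Sym2.map.injective hf).injOn hT
  intro e
  induction e using Sym2.ind with
  | _ u v => exact h u v

theorem not_good_of_forall_inl {V B : Type} [Fintype B] {k : Bool → ℕ} {b : Bool}
    {D : SimpleGraph V} {x y : V} {S : Set (B × B)} (hB : Fintype.card B = k b)
    {c : Sym2 (B ⊕ ((B × B) × V)) → Bool} (h : ∀ a a', a ≠ a' → c s(.inl a, .inl a') = b) :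
    ¬ Good k (glueGraph D x y S) c := by
  intro hc
  refine not_cliqueFree_of_image (S := Finset.univ) (Sum.inl : B → _) ?_
    ((Finset.card_univ.trans hB) ▸ hc b)
  intro a _ a' _ hne
  exact ⟨⟨fun h => hne (Sum.inl.inj h), .inl ⟨a, a', rfl, rfl⟩⟩, h a a' hne⟩

theorem Forces.exists_succ {V : Type} [Finite V] {k : Bool → ℕ} {n : ℕ} {b : Bool}
    {D : SimpleGraph V} {x y : V} (hk : ∀ b, 3 ≤ k b) (hD : Forces k n b D x y) :
    ∃ (V' : Type) (_ : Finite V') (D' : SimpleGraph V') (x' y' : V'),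
      Forces k (n + 1) (!b) D' x' y' := by
  have hk2 : ∀ b, 2 ≤ k b := fun b => (Nat.le_succ 2).trans (hk b)
  let v₀ : Fin (k b) := ⟨0, by have := hk b; omega⟩
  let v₁ : Fin (k b) := ⟨1, by have := hk b; omega⟩
  let v₂ : Fin (k b) := ⟨2, by have := hk b; omega⟩
  have h01 : v₀ < v₁ := by simp [v₀, v₁]
  have h12 : v₁ < v₂ := by simp [v₁, v₂]
  let S : Set (Fin (k b) × Fin (k b)) := {i | i.1 < i.2 ∧ i ≠ (v₀, v₁)}
  have hS : ∀ i ∈ S, i.1 ≠ i.2 := fun i hi => hi.1.ne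
  have hpair : ∀ {i j : Fin (k b) × Fin (k b)}, i.1 < i.2 → j.1 < j.2 →
      s(i.1, i.2) = s(j.1, j.2) → i = j := by
    intro i j hi hj h
    rw [Sym2.eq_iff] at h
    rcases h with h | h
    · exact Prod.ext h.1 h.2
    · rw [h.1, h.2] at hi
      exact (hi.asymm hj).elim
  refine ⟨_, inferInstance, glueGraph D x y S, .inl v₀, .inl v₁,
    ⟨fun h => h01.ne (Sum.inl.inj h), .inl ⟨_, _, rfl, rfl⟩⟩, ?_, ?_, ?_⟩
  · let β : Sym2 (Fin (k b)) → Bool := fun e => if e = s(v₀, v₁) then !b else b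
    obtain ⟨c, hc, -⟩ := hD.exists_good_glueGraph hk2 hS le_rfl (β := β)
      (good_of_eq_outside_edge hk _ h01.ne (by grind) (.inl (by simp [β]))) (by
        intro i hi hb
        refine (hi.2 (hpair hi.1 h01 ?_)).elim
        grind)
    exact ⟨c, hc⟩
  · intro c hc
    by_contra hcon
    have hb : c s(.inl v₀, .inl v₁) = b := by simpa using hcon
    refine not_good_of_forall_inl (by simp) (b := b) ?_ hc
    have hlt : ∀ a a', a < a' → c s(.inl a, .inl a') = b := by
      intro a a' h
      by_cases he : (a, a') = (v₀, v₁)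
      · obtain ⟨rfl, rfl⟩ := Prod.mk.inj he
        exact hb
      · exact hD.eq_of_good_glueGraph hS hc (i := (a, a')) ⟨h, he⟩
    intro a a' h
    rcases h.lt_or_gt with h | h
    · exact hlt a a' h
    · rw [Sym2.eq_swap]
      exact hlt a' a h
  · intro H hH hn
    by_cases hmiss : ∃ a a', a ≠ a' ∧ s(a, a') ≠ s(v₀, v₁) ∧ ¬ H.Adj (.inl a) (.inl a')
    · obtain ⟨a, a', hne, -, hadj⟩ := hmiss
      obtain ⟨c, hc, hβ⟩ := hD.exists_good_glueGraph hk2 hS hH (β := fun _ => b)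
        (good_of_eq_outside_edge hk _ hne (by simp) (.inr hadj)) (by simp)
      exact ⟨c, hc, by simp [hβ]⟩
    · push Not at hmiss
      have h02 : s(v₀, v₂) ≠ s(v₀, v₁) := by simp [h12.ne', h01.ne]
      have hadj := hmiss v₁ v₂ h12.ne (by simp [h01.ne', (h01.trans h12).ne'])
      let β : Sym2 (Fin (k b)) → Bool := fun e => if e = s(v₀, v₂) then !b else b
      obtain ⟨c, hc, hβ⟩ := hD.exists_good_glueGraph hk2 hS hH (β := β)
        (good_of_eq_outside_edge hk _ (h01.trans h12).ne (by grind) (.inl (by simp [β]))) (by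
          intro i hi hb
          obtain rfl : i = (v₀, v₂) := hpair hi.1 (h01.trans h12) (by grind)
          refine (ncard_edgeSet_comap_le (glueMap_injective (hS _ hi))
            (T := H.edgeSet \ {s(.inl v₁, .inl v₂)}) (Set.toFinite _) ?_).trans ?_
          · intro u w huw
            refine ⟨huw, fun h => ?_⟩
            have hrange : Sum.inl v₁ ∈ s(glueMap x y (v₀, v₂) u, glueMap x y (v₀, v₂) w) := by
              rw [Set.mem_singleton_iff.1 h]
              simp
            have hnot : ∀ u, glueMap x y (v₀, v₂) u ≠ Sum.inl v₁ := by
              intro u hu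
              unfold glueMap at hu
              split_ifs at hu
              · exact h01.ne (Sum.inl.inj hu)
              · exact h12.ne' (Sum.inl.inj hu)
            rcases Sym2.mem_iff.1 hrange with h | h
            · exact hnot u h.symm
            · exact hnot w h.symm
          · have := Set.ncard_sdiff_singleton_add_one (s := H.edgeSet)
              (a := s(.inl v₁, .inl v₂)) hadj (Set.toFinite _)
            omega)
      refine ⟨c, hc, ?_⟩
      rw [hβ]
      simp [β, h02.symm]

theorem exists_forces {l r : ℕ} (hl : 3 ≤ l) (hlr : l < r) (n : ℕ) :
    ∃ (b : Bool) (V : Type) (_ : Finite V) (D : SimpleGraph V) (x y : V),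
      Forces (sizes l r) n b D x y := by
  have hk : ∀ b, 3 ≤ sizes l r b := by
    intro b
    cases b <;> simp [sizes] <;> omega
  induction n with
  | zero =>
    obtain ⟨V, hV, D, x, y, hxy, hgood, hforce⟩ := exists_forced_blue_edge hl hlr
    refine ⟨false, V, hV, D, x, y, hxy, hgood, hforce, fun H _ hn => ⟨fun _ => true, ?_, by simp⟩⟩
    have hbot : H = ⊥ := by
      rw [← SimpleGraph.edgeSet_eq_empty]
      exact (Set.ncard_eq_zero (Set.toFinite _)).1 (Nat.le_zero.1 hn)
    intro b
    refine SimpleGraph.CliqueFree.mono ((Nat.le_succ 2).trans (hk b)) ?_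
    rw [SimpleGraph.cliqueFree_two, eq_bot_iff]
    exact fun u v h => hbot ▸ h.1
  | succ n ih =>
    obtain ⟨b, V, hV, D, x, y, hD⟩ := ih
    exact ⟨!b, hD.exists_succ hk⟩

/-- There are graphs without good colorings, all of whose small subgraphs have good colorings. -/
theorem exists_not_good_and_forall_small_good {l r : ℕ} (hl : 3 ≤ l) (hlr : l < r) (n : ℕ) :
    ∃ (V : Type) (_ : Finite V) (F : SimpleGraph V), (∀ c, ¬ Good (sizes l r) F c) ∧
      ∀ H ≤ F, H.edgeSet.ncard ≤ n → ∃ c, Good (sizes l r) H c := by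
  have hk : ∀ b, 3 ≤ sizes l r b := by
    intro b
    cases b <;> simp [sizes] <;> omega
  obtain ⟨b, V, hV, D, x, y, hD⟩ := exists_forces hl hlr n
  let S : Set (Fin (sizes l r b) × Fin (sizes l r b)) := {i | i.1 < i.2}
  have hS : ∀ i ∈ S, i.1 ≠ i.2 := fun i hi => ne_of_lt hi
  refine ⟨_, inferInstance, glueGraph D x y S, fun c hc => ?_, fun H hH hn => ?_⟩
  · refine not_good_of_forall_inl (by simp) (b := b) ?_ hc
    intro a a' h
    rcases h.lt_or_gt with h | h
    · exact hD.eq_of_good_glueGraph hS hc (i := (a, a')) h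
    · rw [Sym2.eq_swap]
      exact hD.eq_of_good_glueGraph hS hc (i := (a', a)) h
  · let v₀ : Fin (sizes l r b) := ⟨0, by have := hk b; omega⟩
    let v₁ : Fin (sizes l r b) := ⟨1, by have := hk b; omega⟩
    obtain ⟨c, hc, -⟩ := hD.exists_good_glueGraph (fun b => (Nat.le_succ 2).trans (hk b)) hS hH
      (β := fun e => if e = s(v₀, v₁) then !b else b)
      (good_of_eq_outside_edge hk _ (a := v₀) (a' := v₁) (by simp [v₀, v₁]) (by grind)
        (.inl (by simp)))
      fun i hi _ => (ncard_edgeSet_comap_le (glueMap_injective (hS i hi)) (T := H.edgeSet)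
        (Set.toFinite _) fun _ _ h => h).trans hn
    exact ⟨c, hc⟩

theorem exists_copy_iff_not_cliqueFree {V : Type*} (F : SimpleGraph V) (c : Sym2 V → Bool)
    (b : Bool) (k : ℕ) :
    (∃ f : Fin k ↪ V, IsCopy (⊤ : SimpleGraph (Fin k)) F f ∧
      ∀ e ∈ (⊤ : SimpleGraph (Fin k)).edgeSet, c (Sym2.map (⇑f) e) = b) ↔
      ¬ (colorGraph F c b).CliqueFree k := by
  rw [SimpleGraph.not_cliqueFree_iff_top_isContained]
  constructor
  · rintro ⟨f, hf, hc⟩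
    exact ⟨⟨⟨f, fun {u v} h => ⟨hf h, hc s(u, v) h⟩⟩, f.injective⟩⟩
  · rintro ⟨f⟩
    refine ⟨f.toEmbedding, fun u v h => (f.toHom.map_adj h).1, fun e he => ?_⟩
    induction e using Sym2.ind with
    | _ u v => exact (f.toHom.map_adj he).2

theorem arrows_top_iff {V : Type*} (F : SimpleGraph V) (l r : ℕ) :
    Arrows F (⊤ : SimpleGraph (Fin l)) (⊤ : SimpleGraph (Fin r)) ↔
      ∀ c, ¬ Good (sizes l r) F c := by
  refine forall_congr' fun c => ?_
  rw [exists_copy_iff_not_cliqueFree, exists_copy_iff_not_cliqueFree, ← not_and_or]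
  simp [Good, sizes, and_comm]

theorem ncard_verts_add_ncard_edgeSet_coe_lt {V : Type*} [Finite V] {G : SimpleGraph V}
    {G' : G.Subgraph} (h : G' ≠ ⊤) :
    Nat.card G'.verts + G'.coe.edgeSet.ncard < Nat.card V + G.edgeSet.ncard := by
  have hverts : Nat.card G'.verts ≤ Nat.card V := Finite.card_subtype_le _
  have hcoe : G'.coe.edgeSet.ncard ≤ G'.edgeSet.ncard := by
    refine Set.ncard_le_ncard_of_injOn (Sym2.map Subtype.val) ?_
      (Sym2.map.injective Subtype.val_injective).injOn (Set.toFinite _)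
    intro e
    induction e using Sym2.ind with
    | _ u v => exact id
  have hedges := Set.ncard_le_ncard G'.edgeSet_subset (Set.toFinite _)
  refine lt_of_le_of_ne (by omega) fun heq => h ?_
  have huniv : G'.verts = Set.univ :=
    Set.eq_of_subset_of_ncard_le (Set.subset_univ _)
      (by rw [Set.ncard_univ, ← Nat.card_coe_set_eq]; omega)
  have hset : G'.edgeSet = G.edgeSet :=
    Set.eq_of_subset_of_ncard_le G'.edgeSet_subset (by omega) (Set.toFinite _)
  refine SimpleGraph.Subgraph.ext huniv ?_
  ext u v
  rw [← SimpleGraph.Subgraph.mem_edgeSet, hset]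
  simp

theorem exists_critical_lt_ncard_edgeSet {l r : ℕ} (hl : 3 ≤ l) (hlr : l < r) (n : ℕ) :
    ∃ F : Σ m : ℕ, SimpleGraph (Fin m),
      Critical F.2 (⊤ : SimpleGraph (Fin l)) (⊤ : SimpleGraph (Fin r)) ∧
      n < F.2.edgeSet.ncard := by
  obtain ⟨V, hV, F, hF, hsmall⟩ := exists_not_good_and_forall_small_good hl hlr n
  let P : (Σ m : ℕ, SimpleGraph (Fin m)) → Prop := fun G =>
    (∃ f : Fin G.1 ↪ V, IsCopy G.2 F f) ∧ ∀ c, ¬ Good (sizes l r) G.2 c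
  have htransport : ∀ (W : Type) (_ : Finite W) (G : SimpleGraph W) (f : W ↪ V), IsCopy G F f →
      (∀ c, ¬ Good (sizes l r) G c) →
      ∃ G', P G' ∧ G'.1 + G'.2.edgeSet.ncard = Nat.card W + G.edgeSet.ncard := by
    intro W _ G f hf hG
    let e := (Finite.equivFin W).symm
    let φ : G.comap e ≃g G := SimpleGraph.Iso.comap e G
    refine ⟨⟨Nat.card W, G.comap e⟩, ⟨⟨e.toEmbedding.trans f, fun u v h => hf h⟩,
      fun c hc => hG _ ((hc.comap e.symm).mono fun u v h => ?_)⟩, ?_⟩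
    · simpa using h
    · rw [Set.ncard_congr' φ.mapEdgeSet]
  have hex : ∃ G, P G := by
    obtain ⟨G, hG, -⟩ := htransport V hV F (Function.Embedding.refl V) (fun _ _ h => h) hF
    exact ⟨G, hG⟩
  obtain ⟨G, ⟨⟨f, hf⟩, hG⟩, hmin⟩ :=
    exists_minimalFor_of_wellFoundedLT P (fun G => G.1 + G.2.edgeSet.ncard) hex
  refine ⟨G, ⟨(arrows_top_iff _ l r).2 hG, fun G' hG' harr => ?_⟩, ?_⟩
  · obtain ⟨K, hK, hcard⟩ := htransport G'.verts inferInstance G'.coe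
      ((Function.Embedding.subtype _).trans f) (fun u v h => hf h.adj_sub)
      ((arrows_top_iff _ l r).1 harr)
    have hlt := ncard_verts_add_ncard_edgeSet_coe_lt hG'
    rw [Nat.card_fin, ← hcard] at hlt
    exact absurd (hmin hK hlt.le) (by simpa using hlt)
  · by_contra hle
    obtain ⟨c, hc⟩ := hsmall (G.2.map f) (by
      rw [SimpleGraph.map_le_iff_le_comap]
      exact fun u v h => hf h) (by
      rw [SimpleGraph.edgeSet_map, Set.ncard_image_of_injective _ f.sym2Map.injective]
      omega)
    exact hG _ ((hc.comap f).mono (by simp))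

/-- for `3 ≤ ℓ < r` the pair `(K_ℓ, K_r)` is Ramsey-infinite: there are
infinitely many pairwise non-isomorphic Ramsey-critical graphs for `(K_ℓ, K_r)`. -/
theorem stmt3 (l r : ℕ) (hl : 3 ≤ l) (hlr : l < r) :
    ∃ F : ℕ → Σ n : ℕ, SimpleGraph (Fin n),
      (∀ i : ℕ, Critical (F i).2 (⊤ : SimpleGraph (Fin l)) (⊤ : SimpleGraph (Fin r))) ∧
      ∀ i j : ℕ, i ≠ j → IsEmpty ((F i).2 ≃g (F j).2) := by
  choose g hg hlt using exists_critical_lt_ncard_edgeSet hl hlr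
  let F : ℕ → Σ n : ℕ, SimpleGraph (Fin n) :=
    fun i => i.rec (g 0) fun _ G => g G.2.edgeSet.ncard
  have hmono : StrictMono fun i => (F i).2.edgeSet.ncard :=
    strictMono_nat_of_lt_succ fun i => hlt _
  refine ⟨F, fun i => by cases i <;> exact hg _, fun i j hij => ⟨fun φ => ?_⟩⟩
  exact hij (hmono.injective (Set.ncard_congr' φ.mapEdgeSet))

end AsymRamsey
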